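/- For every integer k ≥ 2 and every n ∈ ℕ^ℕ, DF(n) = T_{n_0} ∪ K_{n_0}^{-1}(DF(σ(n))), where σ : ℕ^ℕ → ℕ^ℕ is the shift map and T_m = {α ∈ Δ : (m+1)α_{k−1} ≤ α_0}. -/

import Mathlib

open Filter Topology
open scoped Classical

namespace BetaDF

/-- Digit sequences (elements of `Σ = {0,…,k−1}^ℕ` when all entries are `< k`). -/
abbrev Seq : Type := ℕ → ℕ

/-- Lexicographic (strict) order on digit sequences. -/
def seqLt (v w : Seq) : Prop := ∃ r, (∀ s, s < r → v s = w s) ∧ v r < w r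

/-- Lexicographic order on digit sequences. -/
def seqLe (v w : Seq) : Prop := seqLt v w ∨ v = w

/-- The shift map `σ`. -/
def shift (w : Seq) : Seq := fun r => w (r + 1)

/-- Membership in `Σ = {0,…,k−1}^ℕ`. -/
def InSigma (k : ℕ) (w : Seq) : Prop := ∀ r, w r < k

/-- A sequence is maximal if it is `≥` every element of its shift orbit. -/
def IsMaximal (w : Seq) : Prop := ∀ r, seqLe (shift^[r] w) w

/-- Number of occurrences of the digit `i` among the first `r` entries of `w`. -/
def digitCount (w : Seq) (i r : ℕ) : ℕ := ((Finset.range r).filter fun s => w s = i).card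

/-- The ambient Euclidean space `ℝ^k`. -/
abbrev E (k : ℕ) : Type := EuclideanSpace ℝ (Fin k)

/-- The `i`-th coordinate (with junk value `0` for `i ≥ k`). -/
def proj {k : ℕ} (α : E k) (i : ℕ) : ℝ := if h : i < k then α ⟨i, h⟩ else 0

/-- `w` has digit frequency vector `α`. -/
def HasDigitFreq (k : ℕ) (w : Seq) (α : E k) : Prop :=
  ∀ i, i < k →
    Tendsto (fun r => (digitCount w i r : ℝ) / (r : ℝ)) atTop (𝓝 (proj α i))

/-- The standard `(k−1)`-simplex `Δ`. -/
def simplex (k : ℕ) : Set (E k) := {α | (∀ i : Fin k, 0 ≤ α i) ∧ ∑ i, α i = 1}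

/-- The face `F = {α ∈ Δ : α_{k−1} = 0}`. -/
def faceF (k : ℕ) : Set (E k) := {α ∈ simplex k | proj α (k - 1) = 0}

/-- `Δ' = Δ ∖ F`. -/
def simplex' (k : ℕ) : Set (E k) := simplex k \ faceF k

/-- `J(α) = ⌊α₀/α_{k−1}⌋`. -/
noncomputable def Jfun {k : ℕ} (α : E k) : ℕ := ⌊proj α 0 / proj α (k - 1)⌋₊

/-- The map `K_n`. -/
noncomputable def Kmap {k : ℕ} (n : ℕ) (α : E k) : E k :=
  (WithLp.equiv 2 (Fin k → ℝ)).symm fun i =>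
    if (i : ℕ) + 2 < k then proj α ((i : ℕ) + 1) / (1 - proj α 0)
    else if (i : ℕ) + 2 = k then (proj α 0 - n * proj α (k - 1)) / (1 - proj α 0)
    else ((n + 1) * proj α (k - 1) - proj α 0) / (1 - proj α 0)

/-- The continued-fraction map `K : Δ' → Δ'`, `K(α) = K_{J(α)}(α)`. -/
noncomputable def Kstep {k : ℕ} (α : E k) : E k := Kmap (Jfun α) α

/-- The itinerary map `Φ(α)_r = J(K^r(α))`. -/
noncomputable def Phi {k : ℕ} (α : E k) : ℕ → ℕ := fun r => Jfun (Kstep^[r] α)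

/-- The projective embedding `K_n^{-1} : Δ → Δ`. -/
noncomputable def Kinv {k : ℕ} (n : ℕ) (α : E k) : E k :=
  (WithLp.equiv 2 (Fin k → ℝ)).symm fun i =>
    (if (i : ℕ) = 0 then (n + 1) * proj α (k - 2) + n * proj α (k - 1)
      else if (i : ℕ) + 1 = k then proj α (k - 2) + proj α (k - 1)
      else proj α ((i : ℕ) - 1)) /
      ((n + 1) * proj α (k - 2) + n * proj α (k - 1) + 1)

/-- `Υ_{n,r} = K_{n₀}^{-1} ∘ ⋯ ∘ K_{n_r}^{-1}`. -/
noncomputable def Ups {k : ℕ} (n : ℕ → ℕ) : ℕ → E k → E k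
  | 0 => Kinv (n 0)
  | r + 1 => fun α => Ups n r (Kinv (n (r + 1)) α)

/-- `A_{n,r} = Υ_{n,r}(Δ)`. -/
noncomputable def Anr (k : ℕ) (n : ℕ → ℕ) (r : ℕ) : Set (E k) := Ups n r '' simplex k

/-- `F_{n,r} = Υ_{n,r}(F)`. -/
noncomputable def Fnr (k : ℕ) (n : ℕ → ℕ) (r : ℕ) : Set (E k) := Ups n r '' faceF k

/-- Reverse-lexicographic strict order on `ℕ^ℕ`: `a < b` iff `a` exceeds `b`
at the first index where they differ. -/
def revLexLt (a b : ℕ → ℕ) : Prop := ∃ r, (∀ s, s < r → a s = b s) ∧ b r < a r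

/-- The word to which the substitution `Λ_n` sends the digit `i`. -/
def lamWord (k n i : ℕ) : List ℕ :=
  if i + 2 < k then [i + 1]
  else if i + 2 = k then (k - 1) :: List.replicate (n + 1) 0
  else (k - 1) :: List.replicate n 0

/-- The substitution `Λ_n : Σ → Σ`. -/
def lamSub (k n : ℕ) (w : Seq) : Seq := fun m =>
  (((List.range (m + 1)).map fun r => lamWord k n (w r)).flatten).getD m 0

/-- `Λ_{n,r} = Λ_{n₀} ∘ ⋯ ∘ Λ_{n_r}`. -/
def lamChain (k : ℕ) (n : ℕ → ℕ) : ℕ → Seq → Seq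
  | 0 => lamSub k (n 0)
  | r + 1 => fun w => lamChain k n r (lamSub k (n (r + 1)) w)

/-- `Λ_{n₀} ∘ ⋯ ∘ Λ_{n_{R−1}}` for a finite list of indices. -/
def lamList (k : ℕ) : List ℕ → Seq → Seq
  | [], w => w
  | a :: t, w => lamSub k a (lamList k t w)

/-- The constant sequence `(k−1)(k−1)(k−1)…`. -/
def topSeq (k : ℕ) : Seq := fun _ => k - 1

/-- The sequence `(k−1)000…`. -/
def baseSeq (k : ℕ) : Seq := fun m => if m = 0 then k - 1 else 0

/-- `S(n) = lim_{r→∞} Λ_{n,r}((k−1)(k−1)(k−1)…)` (limit in the product topology). -/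
noncomputable def Sseq (k : ℕ) (n : ℕ → ℕ) : Seq :=
  limUnder atTop fun r => lamChain k n r (topSeq k)

/-- The compactified itinerary space `N`: sequences with values in `ℕ∞` such that
all entries from the first `∞` onwards equal `∞`.  Elements with no `∞` entry
correspond to `ℕ^ℕ`; the others are the finite type elements `n₀…n_{R−1}∞`. -/
def NN : Type := {m : ℕ → ℕ∞ // ∀ r, m r = ⊤ → m (r + 1) = ⊤}

/-- Reverse-lexicographic strict order on `N` (`∞` counts as larger than every natural). -/
def nnLt (m n : NN) : Prop := ∃ r, (∀ s, s < r → m.1 s = n.1 s) ∧ n.1 r < m.1 r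

/-- Reverse-lexicographic order on `N`. -/
def nnLe (m n : NN) : Prop := nnLt m n ∨ m = n

/-- The element of `N` determined by an element of `ℕ^ℕ`. -/
def toNN (g : ℕ → ℕ) : NN := ⟨fun r => (g r : ℕ∞), fun r h => absurd h (by simp)⟩

/-- The itinerary `n₀ … n_{R−1} (n_R + 1) 0 0 0 …` (of rational type). -/
def ratSeq (f : ℕ → ℕ) (R : ℕ) : ℕ → ℕ := fun r =>
  if r < R then f r else if r = R then f R + 1 else 0

/-- The finite type element `n₀ … n_{R−1} n_R ∞` of `N`. -/
def finNN (f : ℕ → ℕ) (R : ℕ) : NN :=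
  ⟨fun r => if r ≤ R then (f r : ℕ∞) else ⊤, by
    intro r h
    show (if r + 1 ≤ R then ((f (r + 1) : ℕ∞)) else ⊤) = ⊤
    have h' : (if r ≤ R then ((f r : ℕ∞)) else ⊤) = ⊤ := h
    by_cases h1 : r ≤ R
    · rw [if_pos h1] at h'
      exact absurd h' (by simp)
    · rw [if_neg (by omega : ¬ r + 1 ≤ R)]⟩

/-- The extension of `S` to `N`. -/
noncomputable def SN (k : ℕ) (m : NN) : Seq :=
  if h : ∃ R, m.1 R = ⊤ then
    lamList k ((List.range (Nat.find h)).map fun r => (m.1 r).toNat) (baseSeq k)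
  else Sseq k fun r => (m.1 r).toNat

/-- The metric `d(m,n) = 2^{−X(m,n)}` on `N`, where
`X(m,n) = r + min(m₀+⋯+m_r, n₀+⋯+n_r)` and `r` is the first index where `m,n` differ. -/
noncomputable def dN (m n : NN) : ℝ :=
  if h : m = n then 0
  else
    have hex : ∃ r, m.1 r ≠ n.1 r := by
      by_contra hc
      push Not at hc
      exact h (Subtype.ext (funext hc))
    (2 : ℝ) ^ (-(((Nat.find hex : ℕ) : ℤ) +
      ((min (∑ s ∈ Finset.range (Nat.find hex + 1), m.1 s)
            (∑ s ∈ Finset.range (Nat.find hex + 1), n.1 s)).toNat : ℤ)))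

/-- The symbolic β-shift `X(w)`. -/
def Xset (k : ℕ) (w : Seq) : Set Seq :=
  {v | InSigma k v ∧ ∀ r, seqLe (shift^[r] v) w}

/-- The digit frequency set `DF(w)` of the symbolic β-shift `X(w)`. -/
def DFw (k : ℕ) (w : Seq) : Set (E k) :=
  {α | α ∈ simplex k ∧ ∃ v ∈ Xset k w, HasDigitFreq k v α}

/-- `DF(n) = DF(S(n))` for `n ∈ ℕ^ℕ`. -/
noncomputable def DFn (k : ℕ) (n : ℕ → ℕ) : Set (E k) := DFw k (Sseq k n)

/-- `DF(n) = DF(S(n))` for `n ∈ N`. -/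
noncomputable def DFN (k : ℕ) (m : NN) : Set (E k) := DFw k (SN k m)

/-- The infimax map `I = S ∘ Φ` on `Δ'`, extended by `I(α) = (k−1)000…` on `F`. -/
noncomputable def Ifun (k : ℕ) (α : E k) : Seq :=
  if α ∈ simplex' k then Sseq k (Phi α) else baseSeq k

/-- The simplex `T_m = {α ∈ Δ : (m+1)α_{k−1} ≤ α₀}`. -/
def Tset (k m : ℕ) : Set (E k) :=
  {α ∈ simplex k | ((m : ℝ) + 1) * proj α (k - 1) ≤ proj α 0}

/-- The standard basis vector `e_i`. -/
noncomputable def evec (k i : ℕ) : E k :=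
  (WithLp.equiv 2 (Fin k → ℝ)).symm fun j => if (j : ℕ) = i then 1 else 0

/-- The rational extreme points
`FE(n) = {Υ_{n,s}(e_{k−2}) : n_{s+t} ≠ 0 for some 1 ≤ t ≤ k−2}`. -/
noncomputable def FEset (k : ℕ) (n : ℕ → ℕ) : Set (E k) :=
  {α | ∃ s, (∃ t, 1 ≤ t ∧ t ≤ k - 2 ∧ n (s + t) ≠ 0) ∧ α = Ups n s (evec k (k - 2))}

/-- The set `E(n)` of non-trivial extreme points of `DF(n)`:
extreme points other than `e₀,…,e_{k−2}`. -/
noncomputable def Eset (k : ℕ) (n : ℕ → ℕ) : Set (E k) :=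
  Set.extremePoints ℝ (DFn k n) \ {α | ∃ i, i ≤ k - 2 ∧ α = evec k i}

/-- The fiber `Φ^{-1}(n) ⊆ Δ'`. -/
noncomputable def PhiFiber (k : ℕ) (n : ℕ → ℕ) : Set (E k) :=
  {α ∈ simplex' k | Phi α = n}

/-- `f_β(x) = βx mod 1`. -/
noncomputable def fbeta (β x : ℝ) : ℝ := Int.fract (β * x)

/-- The digit sequence of the greedy β-expansion of `x`: `d_β(x)_r = ⌊β f_β^r(x)⌋`. -/
noncomputable def dbeta (β : ℝ) (x : ℝ) : Seq := fun r => ⌊β * (fbeta β)^[r] x⌋₊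

/-- The digit frequency set `DF(β)` of β-expansions of points of `[0,1]`. -/
noncomputable def DFbeta (k : ℕ) (β : ℝ) : Set (E k) :=
  {α | α ∈ simplex k ∧ ∃ x ∈ Set.Icc (0 : ℝ) 1, HasDigitFreq k (dbeta β x) α}

/-- The sequence `w_β`: if `d_β(1) = d₁…d_{r−1}d_r000…` with `d_r > 0` then `w_β`
is the infinite repetition of `d₁…d_{r−1}(d_r − 1)`; otherwise `w_β = d_β(1)`. -/
noncomputable def wbeta (β : ℝ) : Seq :=
  if h : ∃ r, dbeta β 1 r ≠ 0 ∧ ∀ s, r < s → dbeta β 1 s = 0 then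
    fun m =>
      if m % (Nat.find h + 1) = Nat.find h then dbeta β 1 (Nat.find h) - 1
      else dbeta β 1 (m % (Nat.find h + 1))
  else dbeta β 1

/-- `DF` extended to `[k−1,k]` by `DF(k−1) = F` and `DF(k) = Δ`. -/
noncomputable def DFext (k : ℕ) (β : ℝ) : Set (E k) :=
  if β ≤ (k : ℝ) - 1 then faceF k
  else if (k : ℝ) ≤ β then simplex k
  else DFbeta k β

/-- The mode-locking interval `I_{n₀…n_R}` determined by the word `f 0, …, f R`. -/
noncomputable def Iint (k : ℕ) (f : ℕ → ℕ) (R : ℕ) : Set ℝ :=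
  {β | (k : ℝ) - 1 < β ∧ β < k ∧
    seqLe (Sseq k (ratSeq f R)) (wbeta β) ∧ seqLe (wbeta β) (SN k (finNN f R))}

/-- The frequency vector of the first `s` digits of `w`. -/
noncomputable def freqVec (k : ℕ) (w : Seq) (s : ℕ) : E k :=
  (WithLp.equiv 2 (Fin k → ℝ)).symm fun i => (digitCount w (i : ℕ) s : ℝ) / (s : ℝ)



/-! ### Block sequences -/

/-- The sequence `d 0^z w`. -/
def blk (d z : ℕ) (w : Seq) : Seq := fun m =>
  if m = 0 then d else if m ≤ z then 0 else w (m - (z + 1))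

/-- The substitution `i ↦ (D i) 0^{Z i}`. -/
def sub (D Z : ℕ → ℕ) (w : Seq) : Seq := fun m =>
  (((List.range (m + 1)).map fun r => D (w r) :: List.replicate (Z (w r)) 0).flatten).getD m 0

lemma shift_iter (r : ℕ) (w : Seq) (m : ℕ) : (shift^[r] w) m = w (m + r) := by
  induction r generalizing w with
  | zero => simp
  | succ r ih => rw [Function.iterate_succ_apply, ih]; simp [shift]; congr 1

lemma flat_len (B : ℕ → List ℕ) (hB : ∀ i, B i ≠ []) (M : ℕ) :
    M ≤ (((List.range M).map B).flatten).length := by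
  induction M with
  | zero => simp
  | succ M ih =>
    rw [List.range_succ, List.map_append, List.flatten_append, List.length_append]
    have := List.length_pos_iff.2 (hB M)
    simp at *; omega

lemma flat_getD (B : ℕ → List ℕ) (hB : ∀ i, B i ≠ []) (M N t : ℕ) (h : M ≤ N) (ht : t < M) :
    (((List.range N).map B).flatten).getD t 0 = (((List.range M).map B).flatten).getD t 0 := by
  obtain ⟨d, rfl⟩ := Nat.exists_eq_add_of_le h
  rw [List.range_add, List.map_append, List.flatten_append]
  rw [List.getD_append]
  exact lt_of_lt_of_le ht (flat_len B hB M)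

lemma sub_eq (D Z : ℕ → ℕ) (w : Seq) :
    sub D Z w = blk (D (w 0)) (Z (w 0)) (sub D Z (shift w)) := by
  funext m
  unfold sub blk
  rw [List.range_succ_eq_map, List.map_cons, List.flatten_cons, List.map_map]
  split_ifs with h1 h2
  · subst h1; simp
  · rw [List.getD_append _ _ _ _ (by simp; omega)]
    obtain ⟨t, rfl⟩ := Nat.exists_eq_succ_of_ne_zero h1
    rw [List.getD_cons_succ, List.getD_replicate]
    omega
  · rw [List.getD_append_right _ _ _ _ (by simp; omega)]
    simp only [List.length_cons, List.length_replicate]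
    rw [flat_getD _ _ (m - (Z (w 0) + 1) + 1)]
    · rfl
    · omega
    · omega
    · simp

lemma blk_zero (d z : ℕ) (w : Seq) : blk d z w 0 = d := by simp [blk]

lemma blk_lt_same {d z : ℕ} {a b : Seq} (h : seqLt a b) : seqLt (blk d z a) (blk d z b) := by
  obtain ⟨r, h1, h2⟩ := h
  refine ⟨r + (z + 1), fun s hs => ?_, ?_⟩
  · unfold blk
    split_ifs with h3 h4
    · rfl
    · rfl
    · exact h1 _ (by omega)
  · unfold blk
    rw [if_neg (by omega), if_neg (by omega), if_neg (by omega), if_neg (by omega)]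
    simpa using h2

lemma blk_lt_head {d d' z z' : ℕ} {a b : Seq} (h : d < d') : seqLt (blk d z a) (blk d' z' b) :=
  ⟨0, fun s hs => absurd hs (by omega), by simpa [blk] using h⟩

lemma blk_lt_zeros {d z z' : ℕ} {a b : Seq} (h : z' < z) (hb : b 0 ≠ 0) :
    seqLt (blk d z a) (blk d z' b) := by
  refine ⟨z' + 1, fun s hs => ?_, ?_⟩
  · unfold blk
    split_ifs with h3 h4 <;> first | rfl | omega
  · unfold blk
    rw [if_neg (by omega), if_pos (by omega), if_neg (by omega), if_neg (by omega)]
    simpa using Nat.pos_of_ne_zero hb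

lemma lt_irrefl' {a b : Seq} (h : seqLt a b) (h' : seqLe b a) : False := by
  obtain ⟨r, h1, h2⟩ := h
  rcases h' with ⟨s, h3, h4⟩ | rfl
  · rcases lt_trichotomy r s with h | h | h
    · have := h3 r h; omega
    · subst h; omega
    · have := h1 s h; omega
  · omega

lemma seqLt_trichotomy (a b : Seq) : seqLe a b ∨ seqLt b a := by
  by_cases h : a = b
  · exact Or.inl (Or.inr h)
  · have hex : ∃ r, a r ≠ b r := by
      by_contra hc
      push Not at hc
      exact h (funext hc)
    have hmin : ∀ s, s < Nat.find hex → a s = b s := fun s hs => by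
      by_contra hc
      exact Nat.find_min hex hs hc
    rcases lt_or_gt_of_ne (Nat.find_spec hex) with h1 | h1
    · exact Or.inl (Or.inl ⟨_, hmin, h1⟩)
    · exact Or.inr ⟨_, fun s hs => (hmin s hs).symm, h1⟩

lemma shift_blk (d z : ℕ) (w : Seq) (r : ℕ) (h : z < r) :
    shift^[r] (blk d z w) = shift^[r - (z + 1)] w := by
  funext m
  rw [shift_iter, shift_iter]
  unfold blk
  rw [if_neg (by omega), if_neg (by omega)]
  congr 1; omega

lemma sub_shift (D Z : ℕ → ℕ) (r : ℕ) : ∀ u : Seq,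
    (∃ j, shift^[r] (sub D Z u) = sub D Z (shift^[j] u)) ∨ sub D Z u r = 0 := by
  induction r using Nat.strong_induction_on with
  | _ r ih =>
    intro u
    by_cases h0 : r = 0
    · subst h0; exact Or.inl ⟨0, rfl⟩
    by_cases h1 : r ≤ Z (u 0)
    · right; rw [sub_eq]; simp [blk, h0, h1]
    · rcases ih (r - (Z (u 0) + 1)) (by omega) (shift u) with ⟨j, hj⟩ | h
      · left
        refine ⟨j + 1, ?_⟩
        rw [sub_eq, shift_blk _ _ _ _ (by omega), hj, Function.iterate_succ_apply]
      · right
        rw [sub_eq]; unfold blk; rw [if_neg h0, if_neg h1, h]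

/-! ### The substitution `Λ` -/

/-- Leading digit of `Λ_n(i)`. -/
def lD (k : ℕ) (i : ℕ) : ℕ := if i + 2 < k then i + 1 else k - 1
/-- Number of zeros in `Λ_n(i)`. -/
def lZ (k n : ℕ) (i : ℕ) : ℕ := if i + 2 < k then 0 else if i + 2 = k then n + 1 else n

lemma lamSub_eq_sub (k n : ℕ) : lamSub k n = sub (lD k) (lZ k n) := by
  funext w m
  unfold lamSub sub
  congr 3
  funext r
  unfold lamWord lD lZ
  split_ifs <;> simp

lemma lamSub_blk (k n : ℕ) (w : Seq) :
    lamSub k n w = blk (lD k (w 0)) (lZ k n (w 0)) (lamSub k n (shift w)) := by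
  rw [lamSub_eq_sub]; exact sub_eq _ _ _

lemma lD_pos {k : ℕ} (hk : 2 ≤ k) (i : ℕ) : lD k i ≠ 0 := by unfold lD; split_ifs <;> omega
lemma lD_lt {k : ℕ} (hk : 2 ≤ k) (i : ℕ) : lD k i < k := by unfold lD; split_ifs <;> omega

lemma lamSub_zero {k : ℕ} (n : ℕ) (w : Seq) : lamSub k n w 0 = lD k (w 0) := by
  rw [lamSub_blk, blk_zero]

lemma sub_lt {k : ℕ} (D Z : ℕ → ℕ) (u : Seq) (hk : 0 < k) (h : ∀ r, D (u r) < k) :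
    InSigma k (sub D Z u) := by
  intro r
  rcases sub_shift D Z r u with ⟨j, hj⟩ | h'
  · have := congrFun hj 0
    rw [shift_iter, sub_eq D Z (shift^[j] u), blk_zero, shift_iter] at this
    simp only [zero_add] at this
    rw [this]; exact h j
  · rw [h']; exact hk

lemma lamSub_inSigma {k : ℕ} (hk : 2 ≤ k) (n : ℕ) (w : Seq) : InSigma k (lamSub k n w) := by
  rw [lamSub_eq_sub]
  exact sub_lt _ _ _ (by omega) fun r => lD_lt hk _

lemma lamSub_strictMono {k : ℕ} (hk : 2 ≤ k) (n : ℕ) {a b : Seq}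
    (hb : InSigma k b) (h : seqLt a b) : seqLt (lamSub k n a) (lamSub k n b) := by
  obtain ⟨r, h1, h2⟩ := h
  induction r generalizing a b with
  | zero =>
    rw [lamSub_blk k n a, lamSub_blk k n b]
    have hb0 := hb 0
    by_cases hc : a 0 + 2 = k
    · have e1 : lD k (a 0) = k - 1 := by unfold lD; rw [if_neg (by omega)]
      have e2 : lD k (b 0) = k - 1 := by unfold lD; rw [if_neg (by omega)]
      rw [e1, e2]
      refine blk_lt_zeros ?_ ?_
      · unfold lZ; rw [if_neg (by omega), if_neg (by omega), if_neg (by omega), if_pos hc]; omega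
      · rw [lamSub_zero]; exact lD_pos hk _
    · apply blk_lt_head
      unfold lD; split_ifs <;> omega
  | succ r ih =>
    rw [lamSub_blk k n a, lamSub_blk k n b, h1 0 (by omega)]
    apply blk_lt_same
    exact ih (fun s => hb (s + 1)) (fun s hs => h1 (s + 1) (by omega)) h2

lemma lamSub_mono {k : ℕ} (hk : 2 ≤ k) (n : ℕ) {a b : Seq}
    (hb : InSigma k b) (h : seqLe a b) : seqLe (lamSub k n a) (lamSub k n b) := by
  rcases h with h | rfl
  · exact Or.inl (lamSub_strictMono hk n hb h)
  · exact Or.inr rfl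

/-! ### The limit `S(n)` -/

/-- Agreement of the first `m` digits. -/
def agree (m : ℕ) (u v : Seq) : Prop := ∀ i, i < m → u i = v i

lemma lamSub_agree (k n m : ℕ) : ∀ {u v : Seq}, agree m u v →
    agree m (lamSub k n u) (lamSub k n v) := by
  induction m using Nat.strong_induction_on with
  | _ m ih =>
    intro u v h i hi
    rw [lamSub_blk k n u, lamSub_blk k n v, h 0 (by omega)]
    unfold blk
    split_ifs with h1 h2
    · rfl
    · rfl
    · exact ih (m - 1) (by omega) (fun j hj => h (j + 1) (by omega)) _ (by omega)

lemma lamSub_agree_succ (k n m : ℕ) (hk : 2 ≤ k) (hn : n ≠ 0) (hm : 1 ≤ m) {u v : Seq}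
    (hu : u 0 = k - 1) (h : agree m u v) :
    agree (m + 1) (lamSub k n u) (lamSub k n v) := by
  intro i hi
  rw [lamSub_blk k n u, lamSub_blk k n v, ← h 0 (by omega)]
  have e : lZ k n (u 0) = n := by unfold lZ; rw [if_neg (by omega), if_neg (by omega)]
  rw [e]
  unfold blk
  split_ifs with h1 h2
  · rfl
  · rfl
  · exact lamSub_agree k n (m - 1) (fun j hj => h (j + 1) (by omega)) _ (by omega)

lemma lamChain_succ (k : ℕ) (n : ℕ → ℕ) (r : ℕ) : ∀ w,
    lamChain k n (r + 1) w = lamSub k (n 0) (lamChain k (shift n) r w) := by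
  induction r with
  | zero => intro w; rfl
  | succ r ih =>
    intro w
    show lamChain k n (r + 1) _ = _
    rw [ih]; rfl

lemma lD_top {k : ℕ} (hk : 2 ≤ k) : lD k (k - 1) = k - 1 := by
  unfold lD; rw [if_neg (by omega)]
lemma lZ_top {k : ℕ} (hk : 2 ≤ k) (n : ℕ) : lZ k n (k - 1) = n := by
  unfold lZ; rw [if_neg (by omega), if_neg (by omega)]

lemma lamChain_zero {k : ℕ} (hk : 2 ≤ k) (r : ℕ) : ∀ n, lamChain k n r (topSeq k) 0 = k - 1 := by
  induction r with
  | zero =>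
    intro n
    show lamSub k (n 0) _ 0 = _
    rw [lamSub_zero]; exact lD_top hk
  | succ r ih => intro n; rw [lamChain_succ, lamSub_zero, ih]; exact lD_top hk

lemma lamSub_top {k : ℕ} (hk : 2 ≤ k) : lamSub k 0 (topSeq k) = topSeq k := by
  funext i
  induction i with
  | zero => rw [lamSub_zero]; exact lD_top hk
  | succ i ih =>
    rw [lamSub_blk]
    have e : lZ k 0 (topSeq k 0) = 0 := lZ_top hk 0
    rw [e]
    show lamSub k 0 (topSeq k) i = _
    rw [ih]; rfl

lemma lamChain_allzero {k : ℕ} (hk : 2 ≤ k) (r : ℕ) : ∀ n : ℕ → ℕ, (∀ t, n t = 0) →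
    lamChain k n r (topSeq k) = topSeq k := by
  induction r with
  | zero => intro n h; show lamSub k (n 0) _ = _; rw [h]; exact lamSub_top hk
  | succ r ih => intro n h; rw [lamChain_succ, ih (shift n) (fun t => h (t + 1)), h]; exact lamSub_top hk

lemma chain_stab {k : ℕ} (hk : 2 ≤ k) (m : ℕ) : ∀ n : ℕ → ℕ, ∃ R, ∀ r, R ≤ r →
    agree (m + 1) (lamChain k n r (topSeq k)) (lamChain k n R (topSeq k)) := by
  induction m with
  | zero =>
    intro n
    refine ⟨0, fun r _ i hi => ?_⟩
    obtain rfl : i = 0 := by omega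
    rw [lamChain_zero hk, lamChain_zero hk]
  | succ m ih =>
    intro n
    by_cases hz : ∀ t, n t = 0
    · refine ⟨0, fun r _ i _ => ?_⟩
      rw [lamChain_allzero hk r n hz, lamChain_allzero hk 0 n hz]
    · push Not at hz
      obtain ⟨t, ht⟩ := hz
      induction t generalizing n with
      | zero =>
        obtain ⟨R, hR⟩ := ih (shift n)
        refine ⟨R + 1, fun r hr => ?_⟩
        obtain ⟨r, rfl⟩ : ∃ r', r = r' + 1 := ⟨r - 1, by omega⟩
        rw [lamChain_succ, lamChain_succ]
        exact lamSub_agree_succ k _ _ hk ht (by omega) (lamChain_zero hk _ _) (hR r (by omega))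
      | succ t iht =>
        obtain ⟨R, hR⟩ := iht (shift n) ht
        refine ⟨R + 1, fun r hr => ?_⟩
        obtain ⟨r, rfl⟩ : ∃ r', r = r' + 1 := ⟨r - 1, by omega⟩
        rw [lamChain_succ, lamChain_succ]
        exact lamSub_agree k _ _ (hR r (by omega))

lemma Sseq_spec {k : ℕ} (hk : 2 ≤ k) (n : ℕ → ℕ) (m : ℕ) : ∃ R, ∀ r, R ≤ r →
    agree (m + 1) (lamChain k n r (topSeq k)) (Sseq k n) := by
  choose R hR using fun m => chain_stab hk m n
  have hT : Tendsto (fun r => lamChain k n r (topSeq k)) atTop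
      (𝓝 (fun i => lamChain k n (R i) (topSeq k) i)) := by
    rw [tendsto_pi_nhds]
    intro i
    apply tendsto_const_nhds.congr'
    filter_upwards [eventually_ge_atTop (R i)] with r hr
    exact (hR i r hr i (by omega)).symm
  have hS : Sseq k n = fun i => lamChain k n (R i) (topSeq k) i := hT.limUnder_eq
  refine ⟨(Finset.range (m + 1)).sup R, fun r hr i hi => ?_⟩
  rw [hS]
  exact hR i r (le_trans (Finset.le_sup (f := R) (Finset.mem_range.2 hi)) hr) i (by omega)

lemma Sseq_zero {k : ℕ} (hk : 2 ≤ k) (n : ℕ → ℕ) : Sseq k n 0 = k - 1 := by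
  obtain ⟨R, hR⟩ := Sseq_spec hk n 0
  rw [← hR R le_rfl 0 (by omega), lamChain_zero hk]

lemma Sseq_eq {k : ℕ} (hk : 2 ≤ k) (n : ℕ → ℕ) :
    Sseq k n = lamSub k (n 0) (Sseq k (shift n)) := by
  funext i
  obtain ⟨R, hR⟩ := Sseq_spec hk n i
  obtain ⟨R', hR'⟩ := Sseq_spec hk (shift n) i
  rw [← hR (max R R' + 1) (by omega) i (by omega), lamChain_succ]
  exact lamSub_agree k _ _ (hR' _ (by omega)) i (by omega)

lemma Sseq_inSigma {k : ℕ} (hk : 2 ≤ k) (n : ℕ → ℕ) : InSigma k (Sseq k n) := by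
  rw [Sseq_eq hk]; exact lamSub_inSigma hk _ _

/-! ### Frequencies -/

lemma digitCount_succ (w : Seq) (i r : ℕ) :
    digitCount w i (r + 1) = digitCount w i r + if w r = i then 1 else 0 := by
  unfold digitCount
  rw [Finset.range_add_one, Finset.filter_insert]
  split_ifs with h
  · rw [Finset.card_insert_of_notMem (by simp)]
  · rfl

lemma digitCount_zero (w : Seq) (i : ℕ) : digitCount w i 0 = 0 := by simp [digitCount]

lemma digitCount_le (w : Seq) (i r : ℕ) : digitCount w i r ≤ r := by
  induction r with
  | zero => simp [digitCount_zero]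
  | succ r ih => rw [digitCount_succ]; split_ifs <;> omega

lemma digitCount_mono (w : Seq) (i : ℕ) {r s : ℕ} (h : r ≤ s) :
    digitCount w i r ≤ digitCount w i s := by
  induction s, h using Nat.le_induction with
  | base => rfl
  | succ s _ ih => rw [digitCount_succ]; omega

lemma digitCount_add (w : Seq) (i r s : ℕ) :
    digitCount w i (r + s) = digitCount w i r + digitCount (shift^[r] w) i s := by
  induction s with
  | zero => simp [digitCount_zero]
  | succ s ih => rw [← add_assoc, digitCount_succ, digitCount_succ, ih, shift_iter, add_comm s r]; ring

lemma digitCount_blk (d z : ℕ) (w : Seq) (c : ℕ) :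
    digitCount (blk d z w) c (z + 1) = (if d = c then 1 else 0) + if c = 0 then z else 0 := by
  have : ∀ t, t ≤ z → digitCount (blk d z w) c (t + 1) =
      (if d = c then 1 else 0) + if c = 0 then t else 0 := by
    intro t
    induction t with
    | zero => intro _; rw [digitCount_succ, digitCount_zero, blk_zero]; simp
    | succ t ih =>
      intro ht
      rw [digitCount_succ, ih (by omega)]
      have : blk d z w (t + 1) = 0 := by unfold blk; rw [if_neg (by omega), if_pos ht]
      rw [this]
      by_cases hc : c = 0
      · simp [hc]; ring
      · simp [hc, Ne.symm hc]
  exact this z le_rfl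

lemma sum_digitCount (K : ℕ) (u : Seq) (hu : ∀ r, u r < K) (f : ℕ → ℝ) (j : ℕ) :
    ∑ i ∈ Finset.range j, f (u i) = ∑ i ∈ Finset.range K, (digitCount u i j : ℝ) * f i := by
  induction j with
  | zero => simp [digitCount_zero]
  | succ j ih =>
    rw [Finset.sum_range_succ, ih]
    simp only [digitCount_succ, Nat.cast_add, add_mul, Finset.sum_add_distrib]
    congr 1
    simp [hu j]

/-- Number of digits `c` in the word of `i`. -/
def wcnt (D Z : ℕ → ℕ) (c i : ℕ) : ℕ := (if D i = c then 1 else 0) + if c = 0 then Z i else 0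

/-- Position of the `j`th block. -/
def pos (Z : ℕ → ℕ) (u : Seq) (j : ℕ) : ℕ := ∑ i ∈ Finset.range j, (Z (u i) + 1)

lemma sub_shift_pos (D Z : ℕ → ℕ) (u : Seq) (j : ℕ) :
    shift^[pos Z u j] (sub D Z u) = sub D Z (shift^[j] u) := by
  induction j with
  | zero => simp [pos]
  | succ j ih =>
    have e : pos Z u (j + 1) = (Z (u j) + 1) + pos Z u j := by
      unfold pos; rw [Finset.sum_range_succ]; ring
    have e2 : (shift^[j] u) 0 = u j := by rw [shift_iter]; simp
    rw [e, Function.iterate_add_apply, ih, sub_eq D Z (shift^[j] u), e2,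
      shift_blk _ _ _ _ (by omega), Function.iterate_succ_apply']
    simp

lemma digitCount_pos (D Z : ℕ → ℕ) (u : Seq) (c j : ℕ) :
    digitCount (sub D Z u) c (pos Z u j) = ∑ i ∈ Finset.range j, wcnt D Z c (u i) := by
  induction j with
  | zero => simp [pos, digitCount_zero]
  | succ j ih =>
    have e : pos Z u (j + 1) = pos Z u j + (Z (u j) + 1) := by
      unfold pos; rw [Finset.sum_range_succ]
    have e2 : (shift^[j] u) 0 = u j := by rw [shift_iter]; simp
    rw [e, digitCount_add, ih, sub_shift_pos, sub_eq D Z (shift^[j] u), e2, digitCount_blk,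
      Finset.sum_range_succ]
    rfl

lemma sub_freq (K : ℕ) (D Z : ℕ → ℕ) (u : Seq) (hu : ∀ r, u r < K) (β : ℕ → ℝ)
    (hβ : ∀ i, i < K → Tendsto (fun r => (digitCount u i r : ℝ) / (r : ℝ)) atTop (𝓝 (β i)))
    (hpos : ∑ i ∈ Finset.range K, β i * ((Z i + 1 : ℕ) : ℝ) ≠ 0) (c : ℕ) :
    Tendsto (fun r => (digitCount (sub D Z u) c r : ℝ) / (r : ℝ)) atTop
      (𝓝 ((∑ i ∈ Finset.range K, β i * (wcnt D Z c i : ℝ)) /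
        ∑ i ∈ Finset.range K, β i * ((Z i + 1 : ℕ) : ℝ))) := by
  have key : ∀ f : ℕ → ℕ, Tendsto (fun j : ℕ => ((∑ i ∈ Finset.range j, f (u i) : ℕ) : ℝ) / (j : ℝ))
      atTop (𝓝 (∑ i ∈ Finset.range K, β i * (f i : ℝ))) := by
    intro f
    have : ∀ j : ℕ, ((∑ i ∈ Finset.range j, f (u i) : ℕ) : ℝ) / (j : ℝ) =
        ∑ i ∈ Finset.range K, (digitCount u i j : ℝ) / (j : ℝ) * (f i : ℝ) := by
      intro j
      have := sum_digitCount K u hu (fun i => (f i : ℝ)) j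
      push_cast
      rw [this, Finset.sum_div]
      exact Finset.sum_congr rfl fun i _ => by ring
    simp_rw [this]
    refine tendsto_finsetSum _ fun i hi => ?_
    exact (hβ i (Finset.mem_range.1 hi)).mul_const _
  have hA := key (wcnt D Z c)
  have hB := key (fun i => Z i + 1)
  -- length bound
  obtain ⟨L, hL⟩ : ∃ L, ∀ i, Z (u i) + 1 ≤ L := by
    refine ⟨(Finset.range K).sup (fun i => Z i + 1), fun i => ?_⟩
    exact Finset.le_sup (f := fun i => Z i + 1) (Finset.mem_range.2 (hu i))
  have psucc : ∀ j, pos Z u (j + 1) = pos Z u j + (Z (u j) + 1) := fun j => by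
    unfold pos; rw [Finset.sum_range_succ]
  have pge : ∀ j, j ≤ pos Z u j := by
    intro j
    induction j with
    | zero => omega
    | succ j ih => rw [psucc]; omega
  have ple : ∀ j, pos Z u j ≤ L * j := by
    intro j
    induction j with
    | zero => simp [pos]
    | succ j ih => rw [psucc, Nat.mul_succ]; have := hL j; omega
  have hJ : ∀ r, ∃ j, pos Z u j ≤ r ∧ r < pos Z u (j + 1) := by
    intro r
    have hex : ∃ j, r < pos Z u (j + 1) := ⟨r, by have := pge (r + 1); omega⟩
    refine ⟨Nat.find hex, ?_, Nat.find_spec hex⟩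
    by_cases h0 : Nat.find hex = 0
    · rw [h0]; simp [pos]
    · obtain ⟨t, ht⟩ := Nat.exists_eq_succ_of_ne_zero h0
      have := Nat.find_min hex (m := t) (by omega)
      rw [ht]; simp only [Nat.succ_eq_add_one]; omega
  choose J hJ1 hJ2 using hJ
  have hL1 : 1 ≤ L := by have := hL 0; omega
  have hJt : Tendsto J atTop atTop := by
    rw [tendsto_atTop]
    intro b
    filter_upwards [eventually_ge_atTop (L * (b + 1))] with r hr
    by_contra hc
    push Not at hc
    have h1 := ple (J r + 1)
    have h2 := hJ2 r
    have : L * (J r + 1) ≤ L * (b + 1) := Nat.mul_le_mul_left _ (by omega)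
    omega
  have small : ∀ (X Y : ℕ → ℕ) (a : ℝ), (∀ r, Y (J r) ≤ X r) → (∀ r, X r ≤ Y (J r) + L) →
      Tendsto (fun j : ℕ => (Y j : ℝ) / (j : ℝ)) atTop (𝓝 a) →
      Tendsto (fun r => (X r : ℝ) / (J r : ℝ)) atTop (𝓝 a) := by
    intro X Y a h1 h2 h3
    have h4 := h3.comp hJt
    have h5 : Tendsto (fun r => (L : ℝ) / (J r : ℝ)) atTop (𝓝 0) :=
      (tendsto_const_div_atTop_nhds_zero_nat (L : ℝ)).comp hJt
    have h6 := h4.add h5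
    rw [add_zero] at h6
    refine tendsto_of_tendsto_of_tendsto_of_le_of_le h4 h6 (fun r => ?_) (fun r => ?_)
    · simp only [Function.comp]
      have : (Y (J r) : ℝ) ≤ X r := by exact_mod_cast h1 r
      gcongr
    · simp only [Function.comp]
      rw [← add_div]
      have : (X r : ℝ) ≤ Y (J r) + L := by exact_mod_cast h2 r
      gcongr
  have r1 := small (fun r => r) (pos Z u) _ (fun r => hJ1 r)
    (fun r => by have := hJ2 r; rw [psucc] at this; have := hL (J r); omega) hB
  have r2 := small (fun r => digitCount (sub D Z u) c r)
    (fun j => ∑ i ∈ Finset.range j, wcnt D Z c (u i)) _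
    (fun r => by
      show (∑ i ∈ Finset.range (J r), wcnt D Z c (u i)) ≤ _
      rw [← digitCount_pos]; exact digitCount_mono _ _ (hJ1 r))
    (fun r => by
      show _ ≤ (∑ i ∈ Finset.range (J r), wcnt D Z c (u i)) + L
      rw [← digitCount_pos]
      obtain ⟨t, ht⟩ := Nat.exists_eq_add_of_le (hJ1 r)
      have h1 := digitCount_add (sub D Z u) c (pos Z u (J r)) t
      have h2 := digitCount_le (shift^[pos Z u (J r)] (sub D Z u)) c t
      have h3 := hJ2 r; rw [psucc] at h3
      have h4 := hL (J r)
      show digitCount (sub D Z u) c r ≤ _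
      rw [← ht] at h1
      omega) hA
  refine (r2.div r1 hpos).congr' ?_
  filter_upwards [hJt.eventually_gt_atTop 0] with r hr
  have : (J r : ℝ) ≠ 0 := by exact_mod_cast hr.ne'
  simp only [Pi.div_apply]
  rw [div_div_div_cancel_right₀ this]

lemma proj_of_lt {k : ℕ} (α : E k) {i : ℕ} (h : i < k) : proj α i = α ⟨i, h⟩ := by
  unfold proj; rw [dif_pos h]

lemma proj_fin {k : ℕ} (α : E k) (i : Fin k) : proj α i = α i := by
  rw [proj_of_lt α i.2]

lemma proj_sum {k : ℕ} {α : E k} (h : α ∈ simplex k) : ∑ i ∈ Finset.range k, proj α i = 1 := by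
  rw [Finset.sum_range]
  simp_rw [proj_fin]
  exact h.2

lemma proj_nonneg {k : ℕ} {α : E k} (h : α ∈ simplex k) (i : ℕ) : 0 ≤ proj α i := by
  unfold proj; split_ifs
  · exact h.1 _
  · exact le_rfl

lemma simplex_of_freq {k : ℕ} {w : Seq} {α : E k} (hw : InSigma k w) (h : HasDigitFreq k w α) :
    α ∈ simplex k := by
  constructor
  · intro i
    rw [← proj_fin]
    exact ge_of_tendsto' (h i i.2) fun r => by positivity
  · simp_rw [← proj_fin]
    rw [← Finset.sum_range (fun i => proj α i)]
    have h1 := tendsto_finsetSum (Finset.range k) fun i hi => h i (Finset.mem_range.1 hi)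
    refine tendsto_nhds_unique h1 (tendsto_const_nhds.congr' ?_)
    filter_upwards [eventually_gt_atTop 0] with r hr
    have := sum_digitCount k w hw (fun _ => 1) r
    simp only [Finset.sum_const, mul_one, Finset.card_range, nsmul_eq_mul] at this
    rw [← Finset.sum_div, ← this, div_self]
    exact_mod_cast hr.ne'

/-! ### A sequence with given frequencies -/

lemma exists_freq (K : ℕ) (β : ℕ → ℝ) (h0 : ∀ i, i < K → 0 ≤ β i)
    (h1 : ∑ i ∈ Finset.range K, β i = 1) :
    ∃ u : Seq, (∀ r, u r < K) ∧
      ∀ i, i < K → Tendsto (fun r => (digitCount u i r : ℝ) / (r : ℝ)) atTop (𝓝 (β i)) := by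
  let pick : ℕ → (ℕ → ℕ) → ℕ := fun r c =>
    if h : ∃ i, i < K ∧ (c i : ℝ) < (r + 1) * β i then h.choose else 0
  obtain ⟨st, hst0, hst'⟩ : ∃ st : ℕ → ℕ → ℕ, (∀ i, st 0 i = 0) ∧
      ∀ r i, st (r + 1) i = st r i + if pick r (st r) = i then 1 else 0 :=
    ⟨fun r => Nat.rec (fun _ => 0)
      (fun r c => fun i => c i + if pick r c = i then 1 else 0) r, fun i => rfl, fun r i => rfl⟩
  obtain ⟨u, hu⟩ : ∃ u : Seq, ∀ r, u r = pick r (st r) := ⟨fun r => pick r (st r), fun r => rfl⟩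
  have hst : ∀ r i, st (r + 1) i = st r i + if u r = i then 1 else 0 := fun r i => by
    rw [hst', hu]
  have hcnt : ∀ r i, digitCount u i r = st r i := by
    intro r i
    induction r with
    | zero => rw [digitCount_zero, hst0]
    | succ r ih => rw [digitCount_succ, hst, ih]
  have hpick : ∀ r, (∑ i ∈ Finset.range K, st r i = r) →
      u r < K ∧ (Nat.cast (st r (u r)) : ℝ) < (r + 1) * β (u r) := by
    intro r hr
    have hex : ∃ i, i < K ∧ (st r i : ℝ) < (r + 1) * β i := by
      by_contra hc
      push Not at hc
      have h2 : ∑ i ∈ Finset.range K, ((r : ℝ) + 1) * β i ≤ ∑ i ∈ Finset.range K, (st r i : ℝ) :=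
        Finset.sum_le_sum fun i hi => hc i (Finset.mem_range.1 hi)
      rw [← Finset.mul_sum, h1] at h2
      have h3 : ∑ i ∈ Finset.range K, (st r i : ℝ) = r := by exact_mod_cast hr
      linarith
    have : u r = hex.choose := by rw [hu]; exact dif_pos hex
    rw [this]
    exact hex.choose_spec
  have hsum : ∀ r, ∑ i ∈ Finset.range K, st r i = r := by
    intro r
    induction r with
    | zero => exact Finset.sum_eq_zero fun i _ => hst0 i
    | succ r ih =>
      have := (hpick r ih).1
      simp_rw [hst, Finset.sum_add_distrib, ih]
      simp [this]
  have hup : ∀ r i, i < K → (st r i : ℝ) ≤ r * β i + 1 := by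
    intro r
    induction r with
    | zero => intro i _; rw [hst0]; simp
    | succ r ih =>
      intro i hi
      rw [hst]
      push_cast
      split_ifs with h
      · have := (hpick r (hsum r)).2
        rw [h] at this
        linarith
      · have := ih i hi
        have := h0 i hi
        push_cast
        nlinarith
  refine ⟨u, fun r => (hpick r (hsum r)).1, fun i hi => ?_⟩
  have hlo : ∀ r : ℕ, (r : ℝ) * β i - K ≤ st r i := by
    intro r
    have e1 : ∑ j ∈ Finset.range K, ((r : ℝ) * β j + 1 - st r j) = K := by
      rw [Finset.sum_sub_distrib, Finset.sum_add_distrib, ← Finset.mul_sum, h1]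
      have h3 : ∑ i ∈ Finset.range K, (st r i : ℝ) = r := by exact_mod_cast hsum r
      rw [h3]; simp
    have e2 := Finset.single_le_sum (f := fun j => (r : ℝ) * β j + 1 - st r j)
      (fun j hj => by have := hup r j (Finset.mem_range.1 hj); linarith)
      (Finset.mem_range.2 hi)
    simp only [e1] at e2
    linarith
  have z1 := tendsto_const_div_atTop_nhds_zero_nat (1 : ℝ)
  have z2 := tendsto_const_div_atTop_nhds_zero_nat (K : ℝ)
  have c : Tendsto (fun _ : ℕ => β i) atTop (𝓝 (β i)) := tendsto_const_nhds
  have l1 := c.sub z2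
  have l2 := c.add z1
  rw [sub_zero] at l1
  rw [add_zero] at l2
  refine tendsto_of_tendsto_of_tendsto_of_le_of_le' l1 l2 ?_ ?_
  · filter_upwards [eventually_gt_atTop 0] with r hr
    have hr' : (0 : ℝ) < r := by exact_mod_cast hr
    rw [hcnt, le_div_iff₀ hr', sub_mul, div_mul_cancel₀ _ hr'.ne']
    linarith [hlo r]
  · filter_upwards [eventually_gt_atTop 0] with r hr
    have hr' : (0 : ℝ) < r := by exact_mod_cast hr
    rw [hcnt, div_le_iff₀ hr', add_mul, div_mul_cancel₀ _ hr'.ne']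
    linarith [hup r i hi]

/-! ### The inclusion `⊇` -/

lemma T_subset {k : ℕ} (hk : 2 ≤ k) (m : ℕ) (w' : Seq) (hw' : w' 0 = k - 1) {α : E k}
    (hα : α ∈ Tset k m) : α ∈ DFw k (lamSub k m w') := by
  obtain ⟨hs, hT⟩ := hα
  refine ⟨hs, ?_⟩
  have hsum := proj_sum hs
  have hnn := proj_nonneg hs
  set a := proj α with ha
  set L : ℝ := 1 - (m + 1) * a (k - 1) with hL
  have h2 : a 0 + a (k - 1) ≤ 1 := by
    rw [← hsum, ← Finset.sum_pair (f := a) (show (0 : ℕ) ≠ k - 1 by omega)]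
    apply Finset.sum_le_sum_of_subset_of_nonneg
    · intro i hi
      simp only [Finset.mem_insert, Finset.mem_singleton] at hi
      exact Finset.mem_range.2 (by omega)
    · intro i _ _; exact hnn i
  have hLpos : 0 < L := by
    have h3 := hnn (k - 1)
    rcases h3.eq_or_lt with h | h
    · rw [hL, ← h]; norm_num
    · rw [hL]; linarith
  let D : ℕ → ℕ := fun i => i
  let Z : ℕ → ℕ := fun i => if i = k - 1 then m + 1 else 0
  let β : ℕ → ℝ := fun i => (a i - if i = 0 then (m + 1) * a (k - 1) else 0) / L
  have hβ0 : ∀ i, i < k → 0 ≤ β i := by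
    intro i _
    apply div_nonneg _ hLpos.le
    split_ifs with h
    · subst h; linarith
    · have := hnn i; linarith
  have hβs : ∑ i ∈ Finset.range k, β i = 1 := by
    simp only [β]
    rw [← Finset.sum_div, Finset.sum_sub_distrib, hsum, Finset.sum_ite_eq',
      if_pos (Finset.mem_range.2 (by omega)), div_self hLpos.ne']
  have hβl : β (k - 1) = a (k - 1) / L := by
    simp only [β]; rw [if_neg (by omega), sub_zero]
  have hZ : ∑ i ∈ Finset.range k, β i * (Z i : ℝ) = a (k - 1) / L * (m + 1) := by
    rw [Finset.sum_eq_single (k - 1)]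
    · rw [hβl]; simp [Z]
    · intro i _ hi; simp [Z, hi]
    · intro h; exact absurd (Finset.mem_range.2 (by omega)) h
  have hlen : ∑ i ∈ Finset.range k, β i * ((Z i + 1 : ℕ) : ℝ) = 1 / L := by
    push_cast
    simp_rw [mul_add, mul_one]
    rw [Finset.sum_add_distrib, hβs, hZ]
    field_simp
    rw [hL]; ring
  obtain ⟨u, hu, hf⟩ := exists_freq k β hβ0 hβs
  refine ⟨sub D Z u, ⟨sub_lt _ _ _ (by omega) hu, ?_⟩, ?_⟩
  · intro r
    left
    rw [lamSub_blk, hw', lD_top hk, lZ_top hk]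
    rcases sub_shift D Z r u with ⟨j, hj⟩ | h
    · rw [hj, sub_eq]
      set i := (shift^[j] u) 0 with hi
      have hik : i < k := by rw [hi, shift_iter]; exact hu _
      by_cases hc : i = k - 1
      · have e : Z i = m + 1 := by simp [Z, hc]
        have e' : D i = k - 1 := hc
        rw [e, e']
        exact blk_lt_zeros (by omega) (by rw [lamSub_zero]; exact lD_pos hk _)
      · apply blk_lt_head
        show i < _
        omega
    · refine ⟨0, fun s hs => absurd hs (by omega), ?_⟩
      rw [shift_iter, blk_zero, zero_add, h]; omega
  · intro c hc
    have := sub_freq k D Z u hu β hf (by rw [hlen]; positivity) c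
    convert this using 2
    rw [hlen]
    simp only [wcnt]
    push_cast
    simp_rw [mul_add]
    rw [Finset.sum_add_distrib]
    have e1 : ∑ i ∈ Finset.range k, β i * (if D i = c then (1 : ℝ) else 0) = β c := by
      simp [D, hc]
    rw [e1]
    by_cases h0 : c = 0
    · subst h0
      simp only [if_true]
      rw [hZ]
      simp only [β, if_true]
      field_simp
      rw [ha]; ring
    · simp only [h0, if_false, mul_zero, Finset.sum_const_zero, β]
      field_simp
      simp [ha]

lemma Kinv_apply {k : ℕ} (n : ℕ) (α : E k) {i : ℕ} (hi : i < k) :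
    proj (Kinv n α) i = (if i = 0 then (n + 1) * proj α (k - 2) + n * proj α (k - 1)
      else if i + 1 = k then proj α (k - 2) + proj α (k - 1)
      else proj α (i - 1)) /
      ((n + 1) * proj α (k - 2) + n * proj α (k - 1) + 1) := by
  rw [proj_of_lt _ hi]; rfl

lemma Kinv_subset {k : ℕ} (hk : 2 ≤ k) (m : ℕ) (w' : Seq) (hw' : w' 0 = k - 1)
    (hws : InSigma k w') {α : E k} (hα : α ∈ DFw k w') :
    Kinv m α ∈ DFw k (lamSub k m w') := by
  obtain ⟨hs, v, ⟨hv, hvX⟩, hf⟩ := hα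
  have hsum := proj_sum hs
  have hnn := proj_nonneg hs
  have hfreq : HasDigitFreq k (lamSub k m v) (Kinv m α) := by
    rw [lamSub_eq_sub]
    intro c hc
    rw [Kinv_apply m α hc]
    obtain ⟨K, rfl⟩ : ∃ K, k = K + 2 := ⟨k - 2, by omega⟩
    have lz1 : lZ (K + 2) m (K + 1) = m := by unfold lZ; simp
    have lz2 : lZ (K + 2) m K = m + 1 := by unfold lZ; simp
    have lz3 : ∀ i ∈ Finset.range K, lZ (K + 2) m i = 0 := fun i hi => by
      unfold lZ; rw [if_pos (by have := Finset.mem_range.1 hi; omega)]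
    have ld1 : lD (K + 2) (K + 1) = K + 1 := by unfold lD; simp
    have ld2 : lD (K + 2) K = K + 1 := by unfold lD; simp
    have ld3 : ∀ i ∈ Finset.range K, lD (K + 2) i = i + 1 := fun i hi => by
      unfold lD; rw [if_pos (by have := Finset.mem_range.1 hi; omega)]
    have e1 : K + 2 - 2 = K := by omega
    have e2 : K + 2 - 1 = K + 1 := by omega
    rw [e1, e2]
    set a := proj α with ha
    rw [Finset.sum_range_succ, Finset.sum_range_succ] at hsum
    have hlen : ∑ i ∈ Finset.range (K + 2), a i * ((lZ (K + 2) m i + 1 : ℕ) : ℝ) =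
        (m + 1) * a K + m * a (K + 1) + 1 := by
      rw [Finset.sum_range_succ, Finset.sum_range_succ, lz1, lz2,
        Finset.sum_congr rfl (g := a) fun i hi => by rw [lz3 i hi]; simp]
      push_cast
      linear_combination hsum
    have hpos : (0 : ℝ) < (m + 1) * a K + m * a (K + 1) + 1 := by
      have := hnn K; have := hnn (K + 1); positivity
    have := sub_freq (K + 2) (lD (K + 2)) (lZ (K + 2) m) v hv a hf
      (by rw [hlen]; exact hpos.ne') c
    convert this using 2
    rw [hlen]
    congr 1
    simp only [wcnt]
    rw [Finset.sum_range_succ, Finset.sum_range_succ, lz1, lz2, ld1, ld2]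
    by_cases h0 : c = 0
    · subst h0
      rw [Finset.sum_eq_zero]
      · simp; ring
      · intro i hi
        rw [lz3 i hi, ld3 i hi]; simp
    · by_cases h1 : c = K + 1
      · subst h1
        rw [Finset.sum_eq_zero]
        · simp
        · intro i hi
          rw [ld3 i hi]
          have := Finset.mem_range.1 hi
          simp; omega
      · rw [Finset.sum_eq_single (c - 1)]
        · rw [ld3 (c - 1) (Finset.mem_range.2 (by omega))]
          simp [h0, h1, Ne.symm h1, show c - 1 + 1 = c by omega]
        · intro i hi hne
          rw [ld3 i hi]
          simp [h0, show i + 1 ≠ c by omega]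
        · intro h; exact absurd (Finset.mem_range.2 (by omega)) h
  have hin := lamSub_inSigma hk m v
  refine ⟨simplex_of_freq hin hfreq, lamSub k m v, ⟨hin, ?_⟩, hfreq⟩
  intro r
  rcases sub_shift (lD k) (lZ k m) r v with ⟨j, hj⟩ | h
  · rw [← lamSub_eq_sub] at hj
    rw [hj]
    exact lamSub_mono hk m hws (hvX j)
  · left
    refine ⟨0, fun s hs => absurd hs (by omega), ?_⟩
    rw [shift_iter, zero_add, lamSub_eq_sub, h, ← lamSub_eq_sub, lamSub_zero, hw', lD_top hk]
    omega

/-! ### The inclusion `⊆` -/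

lemma exists_blocks (v : Seq) (h : ∀ p, ∃ p', p ≤ p' ∧ v p' ≠ 0) :
    ∃ q z : ℕ → ℕ, (∀ N, q (N + 1) = q N + z N + 1) ∧ (∀ N, v (q N) ≠ 0) ∧
      (∀ N t, 0 < t → t ≤ z N → v (q N + t) = 0) ∧ ∀ t, t < q 0 → v t = 0 := by
  have hinf : (setOf fun p => v p ≠ 0).Infinite := by
    apply Set.infinite_of_not_bddAbove
    rintro ⟨b, hb⟩
    obtain ⟨p, hp1, hp2⟩ := h (b + 1)
    have := hb hp2
    omega
  have hmono : StrictMono (Nat.nth fun p => v p ≠ 0) := Nat.nth_strictMono hinf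
  refine ⟨Nat.nth fun p => v p ≠ 0, fun N => Nat.nth (fun p => v p ≠ 0) (N + 1) -
    Nat.nth (fun p => v p ≠ 0) N - 1, ?_, ?_, ?_, ?_⟩
  · intro N
    have := hmono (Nat.lt_succ_self N)
    simp only [Nat.succ_eq_add_one] at this
    beta_reduce
    omega
  · intro N; exact Nat.nth_mem_of_infinite hinf N
  · intro N t ht1 ht2
    by_contra hc
    obtain ⟨i, hi⟩ : ∃ i, Nat.nth (fun p => v p ≠ 0) i = Nat.nth (fun p => v p ≠ 0) N + t :=
      ⟨_, Nat.nth_count (p := fun p => v p ≠ 0) hc⟩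
    have h1 : N < i := hmono.lt_iff_lt.1 (by omega)
    beta_reduce at ht2
    have h2 : i < N + 1 := hmono.lt_iff_lt.1 (by omega)
    omega
  · intro t ht
    by_contra hc
    obtain ⟨i, hi⟩ : ∃ i, Nat.nth (fun p => v p ≠ 0) i = t :=
      ⟨_, Nat.nth_count (p := fun p => v p ≠ 0) hc⟩
    have h1 : i < 0 := hmono.lt_iff_lt.1 (by omega)
    omega

lemma shift_q_blk (v : Seq) (q z : ℕ → ℕ) (hq : ∀ N, q (N + 1) = q N + z N + 1)
    (hzero : ∀ N t, 0 < t → t ≤ z N → v (q N + t) = 0) (l : ℕ) :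
    shift^[q l] v = blk (v (q l)) (z l) (shift^[q (l + 1)] v) := by
  funext i
  rw [shift_iter]
  unfold blk
  split_ifs with h1 h2
  · rw [h1, zero_add]
  · rw [add_comm]; exact hzero l i (by omega) h2
  · rw [shift_iter, hq]; congr 1; omega

lemma core_lt {k : ℕ} (hk : 2 ≤ k) (m : ℕ) (v : Seq) (q z : ℕ → ℕ) (s : ℕ → ℤ) (v' : Seq)
    (hv : InSigma k v) (hq : ∀ N, q (N + 1) = q N + z N + 1) (hnz : ∀ N, v (q N) ≠ 0)
    (hzero : ∀ N t, 0 < t → t ≤ z N → v (q N + t) = 0)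
    (hz : ∀ N, v (q N) = k - 1 → m ≤ z N)
    (hs : ∀ N, s (N + 1) = s N + (if v (q N) = k - 1 then (m : ℤ) + 1 else 0) - z N)
    (hv' : ∀ N, v' N = if v (q N) + 1 < k then v (q N) - 1
      else if ∀ l, N < l → s N < s l then k - 1 else k - 2) (r : ℕ) :
    ∀ (l : ℕ) (w : Seq), (∀ i, i < r → w i = v' (l + i)) → w r < v' (l + r) →
      (∀ l', l ≤ l' → s l ≤ s l') → seqLt (lamSub k m w) (shift^[q l] v) := by
  have hhead : ∀ l, (shift^[q l] v) 0 ≠ 0 := fun l => by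
    rw [shift_iter, zero_add]; exact hnz l
  induction r with
  | zero =>
    intro l w _ h2 hmin
    have h2 : w 0 < v' l := h2
    rw [lamSub_blk, shift_q_blk v q z hq hzero l]
    have hd := hv (q l)
    have hd0 := hnz l
    have hsl := hs l
    have hml := hmin (l + 1) (by omega)
    have hv'l := hv' l
    by_cases hA : v (q l) + 1 < k
    · rw [if_pos hA] at hv'l
      apply blk_lt_head
      unfold lD; rw [if_pos (by omega)]; omega
    · have hdk : v (q l) = k - 1 := by omega
      rw [if_neg hA] at hv'l
      rw [if_pos hdk] at hsl
      by_cases hw : w 0 + 2 < k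
      · apply blk_lt_head
        unfold lD; rw [if_pos hw]; omega
      · by_cases hB : ∀ l', l < l' → s l < s l'
        · rw [if_pos hB] at hv'l
          have h3 := hB (l + 1) (by omega)
          have e1 : lD k (w 0) = k - 1 := by unfold lD; rw [if_neg hw]
          have e2 : lZ k m (w 0) = m + 1 := by
            unfold lZ; rw [if_neg hw, if_pos (by omega)]
          rw [e1, e2, hdk]
          exact blk_lt_zeros (by omega) (hhead _)
        · rw [if_neg hB] at hv'l
          omega
  | succ r ih =>
    intro l w h1 h2 hmin
    have h10 : w 0 = v' l := h1 0 (by omega)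
    have step : (∀ l', l + 1 ≤ l' → s (l + 1) ≤ s l') →
        seqLt (lamSub k m (shift w)) (shift^[q (l + 1)] v) := fun hm =>
      ih (l + 1) (shift w)
        (fun i hi => by
          show w (i + 1) = _
          rw [h1 (i + 1) (by omega)]; congr 1; ring)
        (by
          show w (r + 1) < _
          have : l + 1 + r = l + (r + 1) := by ring
          rw [this]; exact h2) hm
    rw [lamSub_blk, shift_q_blk v q z hq hzero l, h10]
    have hd := hv (q l)
    have hd0 := hnz l
    have hsl := hs l
    have hml := hmin (l + 1) (by omega)
    have hv'l := hv' l
    by_cases hA : v (q l) + 1 < k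
    · rw [if_pos hA] at hv'l
      rw [if_neg (by omega)] at hsl
      have e1 : lD k (v' l) = v (q l) := by unfold lD; rw [if_pos (by omega)]; omega
      have e2 : lZ k m (v' l) = z l := by unfold lZ; rw [if_pos (by omega)]; omega
      rw [e1, e2]
      apply blk_lt_same
      apply step
      intro l' hl'
      have := hmin l' (by omega)
      omega
    · have hdk : v (q l) = k - 1 := by omega
      have hzl := hz l hdk
      rw [if_neg hA] at hv'l
      rw [if_pos hdk] at hsl
      by_cases hB : ∀ l', l < l' → s l < s l'
      · rw [if_pos hB] at hv'l
        have h3 := hB (l + 1) (by omega)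
        rw [hv'l, lD_top hk, lZ_top hk, hdk]
        have e : z l = m := by omega
        rw [e]
        apply blk_lt_same
        apply step
        intro l' hl'
        have := hB l' (by omega)
        omega
      · rw [if_neg hB] at hv'l
        have e1 : lD k (v' l) = k - 1 := by unfold lD; rw [if_neg (by omega)]
        have e2 : lZ k m (v' l) = m + 1 := by
          unfold lZ; rw [if_neg (by omega), if_pos (by omega)]
        rw [e1, e2, hdk]
        by_cases hC : z l = m + 1
        · rw [hC]
          apply blk_lt_same
          apply step
          intro l' hl'
          have := hmin l' (by omega)
          omega
        · exact blk_lt_zeros (by omega) (hhead _)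

lemma Kmap_apply {k : ℕ} (n : ℕ) (α : E k) {i : ℕ} (hi : i < k) :
    proj (Kmap n α) i = if i + 2 < k then proj α (i + 1) / (1 - proj α 0)
    else if i + 2 = k then (proj α 0 - n * proj α (k - 1)) / (1 - proj α 0)
    else ((n + 1) * proj α (k - 1) - proj α 0) / (1 - proj α 0) := by
  rw [proj_of_lt _ hi]; rfl

lemma Kinv_Kmap {k : ℕ} (hk : 2 ≤ k) (n : ℕ) (α : E k) (h : 1 - proj α 0 ≠ 0) :
    Kinv n (Kmap n α) = α := by
  ext i
  rw [← proj_fin, ← proj_fin, Kinv_apply n _ i.2, Kmap_apply n α (show k - 2 < k by omega),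
    Kmap_apply n α (show k - 1 < k by omega)]
  rw [if_neg (show ¬ (k - 2 + 2 < k) by omega), if_pos (show k - 2 + 2 = k by omega),
    if_neg (show ¬ (k - 1 + 2 < k) by omega), if_neg (show ¬ (k - 1 + 2 = k) by omega)]
  have hi := i.2
  have hD : ((n : ℝ) + 1) * ((proj α 0 - n * proj α (k - 1)) / (1 - proj α 0)) +
      n * (((n + 1) * proj α (k - 1) - proj α 0) / (1 - proj α 0)) + 1 = 1 / (1 - proj α 0) := by
    field_simp; ring
  rw [hD]
  split_ifs with h0 h1
  · rw [h0]; field_simp; ring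
  · have : (i : ℕ) = k - 1 := by omega
    rw [this]; field_simp; ring
  · rw [Kmap_apply n α (show (i : ℕ) - 1 < k by omega), if_pos (by omega),
      show (i : ℕ) - 1 + 1 = i by omega]
    field_simp

lemma digitCount_allzero (v : Seq) (c p : ℕ) (h : ∀ t, t < p → v t = 0) :
    digitCount v c p = if c = 0 then p else 0 := by
  induction p with
  | zero => simp [digitCount_zero]
  | succ p ih =>
    rw [digitCount_succ, ih fun t ht => h t (by omega), h p (by omega)]
    by_cases hc : c = 0
    · simp [hc]
    · simp [hc, Ne.symm hc]

/-- Running minimum from `N` on of a sequence growing linearly. -/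
lemma running_min (s : ℕ → ℤ) (δ : ℝ) (hδ : 0 < δ)
    (h : Tendsto (fun N => (s N : ℝ) / (N : ℝ)) atTop (𝓝 δ)) :
    ∃ M : ℕ → ℤ, (∀ N, ∃ l, N ≤ l ∧ s l = M N) ∧ (∀ N l, N ≤ l → M N ≤ s l) ∧
      Tendsto (fun N => (M N : ℝ) / (N : ℝ)) atTop (𝓝 δ) := by
  have hr : Tendsto (fun N => (s N : ℝ)) atTop atTop := by
    refine (h.pos_mul_atTop hδ tendsto_natCast_atTop_atTop).congr' ?_
    filter_upwards [eventually_gt_atTop 0] with N hN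
    have : (N : ℝ) ≠ 0 := by exact_mod_cast hN.ne'
    field_simp
  have hsT : Tendsto s atTop atTop := tendsto_intCast_atTop_iff.1 hr
  have hex : ∀ N, ∃ b, (∃ l, N ≤ l ∧ s l = b) ∧ ∀ l, N ≤ l → b ≤ s l := by
    intro N
    have h1 : Tendsto (fun i => s (i + N)) cofinite atTop := by
      rw [Nat.cofinite_eq_atTop]
      exact hsT.comp (tendsto_add_atTop_nat N)
    obtain ⟨a, ha⟩ := h1.exists_forall_le
    refine ⟨s (a + N), ⟨a + N, by omega, rfl⟩, fun l hl => ?_⟩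
    have := ha (l - N)
    simpa [Nat.sub_add_cancel hl] using this
  choose M hM1 hM2 using hex
  refine ⟨M, hM1, hM2, tendsto_order.2 ⟨fun a ha => ?_, fun b hb => ?_⟩⟩
  · obtain ⟨a', h1, h2⟩ := exists_between (max_lt ha hδ)
    have h3 := (tendsto_order.1 h).1 a' h2
    obtain ⟨N0, hN0⟩ := eventually_atTop.1 h3
    filter_upwards [eventually_ge_atTop N0, eventually_gt_atTop 0] with N hN hN'
    obtain ⟨l, hl, hl'⟩ := hM1 N
    have h4 := hN0 l (by omega)
    have hNr : (0 : ℝ) < N := by exact_mod_cast hN'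
    have hlr : (N : ℝ) ≤ l := by exact_mod_cast hl
    rw [lt_div_iff₀ (by linarith)] at h4
    rw [lt_div_iff₀ hNr, ← hl']
    have h5 : 0 < a' := lt_of_le_of_lt (le_max_right _ _) h1
    have h6 : a < a' := lt_of_le_of_lt (le_max_left _ _) h1
    calc a * N < a' * N := by gcongr
      _ ≤ a' * l := by gcongr
      _ < _ := h4
  · filter_upwards [(tendsto_order.1 h).2 b hb] with N hN
    refine lt_of_le_of_lt ?_ hN
    have : (M N : ℝ) ≤ s N := by exact_mod_cast hM2 N N le_rfl
    gcongr

lemma DF_core {k : ℕ} (hk : 2 ≤ k) (m : ℕ) (w' : Seq) (hw' : w' 0 = k - 1) {α : E k}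
    (hα : α ∈ DFw k (lamSub k m w')) (hlt : proj α 0 < (m + 1) * proj α (k - 1)) :
    1 - proj α 0 ≠ 0 ∧ Kmap m α ∈ DFw k w' := by
  obtain ⟨hsx, v, ⟨hv, hX⟩, hf⟩ := hα
  have hsum := proj_sum hsx
  have hnn := proj_nonneg hsx
  have hpos : 0 < proj α (k - 1) := by
    have h0 := hnn 0
    by_contra hc
    have : proj α (k - 1) = 0 := le_antisymm (not_lt.1 hc) (hnn _)
    rw [this] at hlt; linarith
  have h2 : proj α 0 + proj α (k - 1) ≤ 1 := by
    rw [← hsum, ← Finset.sum_pair (f := proj α) (show (0 : ℕ) ≠ k - 1 by omega)]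
    apply Finset.sum_le_sum_of_subset_of_nonneg
    · intro i hi
      simp only [Finset.mem_insert, Finset.mem_singleton] at hi
      exact Finset.mem_range.2 (by omega)
    · intro i _ _; exact hnn i
  have hone : 0 < 1 - proj α 0 := by linarith
  refine ⟨hone.ne', ?_⟩
  -- infinitely many nonzero digits
  have hinf : ∀ p, ∃ p', p ≤ p' ∧ v p' ≠ 0 := by
    intro p
    by_contra hc
    push Not at hc
    have hb : ∀ r, digitCount v (k - 1) r ≤ p := by
      intro r
      rcases le_total r p with h | h
      · exact (digitCount_le _ _ _).trans h
      · obtain ⟨t, rfl⟩ := Nat.exists_eq_add_of_le h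
        rw [digitCount_add, digitCount_allzero (shift^[p] v) (k - 1) t fun i _ => by
          rw [shift_iter]; exact hc _ (by omega), if_neg (by omega)]
        exact digitCount_le _ _ _
    have h3 := hf (k - 1) (by omega)
    have h4 : Tendsto (fun r => (digitCount v (k - 1) r : ℝ) / (r : ℝ)) atTop (𝓝 0) := by
      refine squeeze_zero (fun r => by positivity) (fun r => ?_)
        (tendsto_const_div_atTop_nhds_zero_nat (p : ℝ))
      have : (digitCount v (k - 1) r : ℝ) ≤ p := by exact_mod_cast hb r
      gcongr
    exact hpos.ne' (tendsto_nhds_unique h3 h4)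
  obtain ⟨q, z, hq, hnz, hzero, hinit⟩ := exists_blocks v hinf
  have hz : ∀ N, v (q N) = k - 1 → m ≤ z N := by
    intro N hN
    by_contra hc
    push Not at hc
    have := hX (q N)
    rw [shift_q_blk v q z hq hzero N, lamSub_blk, hw', lD_top hk, lZ_top hk, hN] at this
    refine lt_irrefl' (blk_lt_zeros hc ?_) this
    rw [shift_iter, zero_add]; exact hnz _
  -- counts
  have hcnt : ∀ c N, digitCount v c (q (N + 1)) = digitCount v c (q N) +
      ((if v (q N) = c then 1 else 0) + if c = 0 then z N else 0) := by
    intro c N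
    rw [hq, add_assoc, digitCount_add, shift_q_blk v q z hq hzero N, digitCount_blk]
  have hcnt0 : ∀ c, digitCount v c (q 0) = if c = 0 then q 0 else 0 := fun c =>
    digitCount_allzero v c _ hinit
  have hNq : ∀ N, N + digitCount v 0 (q N) = q N := by
    intro N
    induction N with
    | zero => rw [hcnt0]; simp
    | succ N ih =>
      rw [hcnt, if_neg (hnz N), if_pos rfl, hq]; omega
  have hqt : Tendsto q atTop atTop :=
    tendsto_atTop_mono (fun N => by have := hNq N; show N ≤ q N; omega) tendsto_id
  have hfq : ∀ c, c < k → Tendsto (fun N => (digitCount v c (q N) : ℝ) / (q N : ℝ)) atTop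
      (𝓝 (proj α c)) := fun c hc => (hf c hc).comp hqt
  have hratio : Tendsto (fun N : ℕ => (N : ℝ) / (q N : ℝ)) atTop (𝓝 (1 - proj α 0)) := by
    have h3 := (tendsto_const_nhds (x := (1 : ℝ))).sub (hfq 0 (by omega))
    refine h3.congr' ?_
    filter_upwards [hqt.eventually_gt_atTop 0] with N hN
    have h4 : ((N : ℕ) : ℝ) + digitCount v 0 (q N) = q N := by exact_mod_cast hNq N
    have h5 : (q N : ℝ) ≠ 0 := by exact_mod_cast hN.ne'
    field_simp
    linarith
  have hdiv : ∀ (Y : ℕ → ℝ) (y : ℝ), Tendsto (fun N => Y N / (q N : ℝ)) atTop (𝓝 y) →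
      Tendsto (fun N : ℕ => Y N / (N : ℝ)) atTop (𝓝 (y / (1 - proj α 0))) := by
    intro Y y hY
    refine (hY.div hratio hone.ne').congr' ?_
    filter_upwards [hqt.eventually_gt_atTop 0] with N hN
    have h5 : (q N : ℝ) ≠ 0 := by exact_mod_cast hN.ne'
    simp only [Pi.div_apply]
    rw [div_div_div_cancel_right₀ h5]
  -- height
  obtain ⟨s, hsdef⟩ : ∃ s : ℕ → ℤ, ∀ N, s N =
      ((m : ℤ) + 1) * digitCount v (k - 1) (q N) - digitCount v 0 (q N) := ⟨_, fun N => rfl⟩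
  have hs : ∀ N, s (N + 1) = s N + (if v (q N) = k - 1 then (m : ℤ) + 1 else 0) - z N := by
    intro N
    rw [hsdef, hsdef, hcnt, hcnt, if_neg (hnz N), if_pos rfl, if_neg (show k - 1 ≠ 0 by omega)]
    split_ifs <;> push_cast <;> ring
  have hslim : Tendsto (fun N => (s N : ℝ) / (N : ℝ)) atTop
      (𝓝 (((m + 1) * proj α (k - 1) - proj α 0) / (1 - proj α 0))) := by
    apply hdiv
    have h3 := ((hfq (k - 1) (by omega)).const_mul ((m : ℝ) + 1)).sub (hfq 0 (by omega))
    refine h3.congr fun N => ?_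
    rw [hsdef]; push_cast; ring
  obtain ⟨M, hM1, hM2, hMlim⟩ := running_min s _ (div_pos (by linarith) hone) hslim
  obtain ⟨v', hv'⟩ : ∃ v' : Seq, ∀ N, v' N = if v (q N) + 1 < k then v (q N) - 1
      else if ∀ l, N < l → s N < s l then k - 1 else k - 2 := ⟨_, fun N => rfl⟩
  have htop : ∀ N, v' N = k - 1 ↔ ∀ l, N < l → s N < s l := by
    intro N
    rw [hv']
    have hd := hnz N
    have hd' := hv (q N)
    constructor
    · intro h
      split_ifs at h with h3 h4
      · omega
      · exact h4
      · omega
    · intro h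
      have h3 := h (N + 1) (by omega)
      rw [hs] at h3
      by_cases h4 : v (q N) = k - 1
      · rw [if_neg (by omega), if_pos h]
      · rw [if_neg h4] at h3; omega
  have hMs : ∀ N, M (N + 1) = M N + if v' N = k - 1 then 1 else 0 := by
    intro N
    obtain ⟨l, hl, hl'⟩ := hM1 N
    obtain ⟨l1, hl1, hl1'⟩ := hM1 (N + 1)
    have a1 := hM2 N l1 (by omega)
    have a2 := hM2 N N le_rfl
    have a3 := hM2 (N + 1) (N + 1) le_rfl
    split_ifs with h
    · have h3 := (htop N).1 h
      have h4 := h3 l1 (by omega)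
      have h5 : l = N := by
        by_contra hne
        have := h3 l (by omega)
        omega
      subst h5
      have h6 := hs l
      have h7 : z l ≥ m ∨ v (q l) ≠ k - 1 := by
        by_cases hh : v (q l) = k - 1
        · exact Or.inl (hz l hh)
        · exact Or.inr hh
      split_ifs at h6 with h8
      · have := hz l h8
        omega
      · omega
    · have h3 := mt (htop N).2 h
      push Not at h3
      obtain ⟨l2, h4, h5⟩ := h3
      have a4 := hM2 (N + 1) l2 (by omega)
      by_cases h6 : l = N
      · subst h6; omega
      · have := hM2 (N + 1) l (by omega)
        omega
  have c1 : ∀ N, (digitCount v' (k - 1) N : ℤ) = M N - M 0 := by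
    intro N
    induction N with
    | zero => simp [digitCount_zero]
    | succ N ih =>
      rw [digitCount_succ, hMs]; push_cast; rw [ih]; ring
  have c2 : ∀ N, digitCount v' (k - 2) N + digitCount v' (k - 1) N =
      digitCount v (k - 1) (q N) := by
    intro N
    induction N with
    | zero => rw [hcnt0, if_neg (by omega)]; simp [digitCount_zero]
    | succ N ih =>
      rw [digitCount_succ, digitCount_succ, hcnt, if_neg (show k - 1 ≠ 0 by omega), ← ih, hv']
      have hd := hnz N
      have hd' := hv (q N)
      split_ifs <;> omega
  have c3 : ∀ i, i + 2 < k → ∀ N, digitCount v' i N = digitCount v (i + 1) (q N) := by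
    intro i hi N
    induction N with
    | zero => rw [hcnt0, if_neg (by omega), digitCount_zero]
    | succ N ih =>
      rw [digitCount_succ, hcnt, if_neg (show i + 1 ≠ 0 by omega), ← ih, hv']
      have hd := hnz N
      have hd' := hv (q N)
      split_ifs <;> omega
  have f1 : Tendsto (fun N => (digitCount v' (k - 1) N : ℝ) / (N : ℝ)) atTop
      (𝓝 (((m + 1) * proj α (k - 1) - proj α 0) / (1 - proj α 0))) := by
    have h3 := hMlim.sub (tendsto_const_div_atTop_nhds_zero_nat (M 0 : ℝ))
    rw [sub_zero] at h3
    refine h3.congr fun N => ?_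
    have : (digitCount v' (k - 1) N : ℝ) = M N - M 0 := by exact_mod_cast c1 N
    rw [this]; ring
  have f2 : Tendsto (fun N => (digitCount v' (k - 2) N : ℝ) / (N : ℝ)) atTop
      (𝓝 ((proj α 0 - m * proj α (k - 1)) / (1 - proj α 0))) := by
    have h3 := (hdiv _ _ (hfq (k - 1) (by omega))).sub f1
    have e : proj α (k - 1) / (1 - proj α 0) -
        ((m + 1) * proj α (k - 1) - proj α 0) / (1 - proj α 0) =
        (proj α 0 - m * proj α (k - 1)) / (1 - proj α 0) := by ring
    rw [e] at h3
    refine h3.congr fun N => ?_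
    have : (digitCount v' (k - 2) N : ℝ) + digitCount v' (k - 1) N =
        digitCount v (k - 1) (q N) := by exact_mod_cast c2 N
    rw [← this]; ring
  have hv'in : InSigma k v' := by
    intro N
    rw [hv']
    have hd' := hv (q N)
    split_ifs <;> omega
  have hfreq : HasDigitFreq k v' (Kmap m α) := by
    intro i hi
    rw [Kmap_apply m α hi]
    split_ifs with h3 h4
    · refine (hdiv _ _ (hfq (i + 1) (by omega))).congr fun N => ?_
      rw [c3 i h3]
    · have : i = k - 2 := by omega
      rw [this]; exact f2
    · have : i = k - 1 := by omega
      rw [this]; exact f1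
  refine ⟨simplex_of_freq hv'in hfreq, v', ⟨hv'in, fun r => ?_⟩, hfreq⟩
  by_cases hr : v' r = k - 1
  · rcases seqLt_trichotomy (shift^[r] v') w' with h | ⟨i, h3, h4⟩
    · exact h
    · exfalso
      have hun := (htop r).1 hr
      refine lt_irrefl' (core_lt hk m v q z s v' hv hq hnz hzero hz hs hv' i r w' ?_ ?_ ?_) (hX (q r))
      · intro j hj
        rw [h3 j hj, shift_iter, add_comm]
      · rw [shift_iter, add_comm] at h4; exact h4
      · intro l' hl'
        rcases hl'.eq_or_lt with rfl | h5
        · exact le_rfl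
        · exact (hun l' h5).le
  · left
    refine ⟨0, fun s hs => absurd hs (by omega), ?_⟩
    rw [shift_iter, zero_add, hw']
    have := hv'in r
    omega

/-- `DF(n) = T_{n₀} ∪ K_{n₀}^{-1}(DF(σ(n)))`. -/
theorem stmt4 (k : ℕ) (hk : 2 ≤ k) (n : ℕ → ℕ) :
    DFn k n = Tset k (n 0) ∪ Kinv (n 0) '' DFn k (shift n) := by
  have hw' := Sseq_zero hk (shift n)
  have hin := Sseq_inSigma hk (shift n)
  unfold DFn
  rw [Sseq_eq hk n]
  ext α
  constructor
  · intro h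
    by_cases hT : ((n 0 : ℕ) + 1 : ℝ) * proj α (k - 1) ≤ proj α 0
    · exact Or.inl ⟨h.1, hT⟩
    · right
      obtain ⟨h1, h2⟩ := DF_core hk (n 0) _ hw' h (not_le.1 hT)
      exact ⟨_, h2, Kinv_Kmap hk _ _ h1⟩
  · rintro (h | ⟨β, hβ, rfl⟩)
    · exact T_subset hk _ _ hw' h
    · exact Kinv_subset hk _ _ hw' hin hβ

end BetaDF
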